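/- arXiv:1306.2020 — 3 statements merged into one kernel-verified Lean document; each statement's English description precedes it below -/
import Mathlib

section
/- For every ε > 0 there exists N such that every tournament T on n ≥ N vertices satisfies c₄(T) ≤ t₄(T) + ε. This inequality is tight: it holds with equality in the limit for the circular tournaments, where t₄ = c₄ = 1/2. -/
open Finset

/-- A tournament: an irreflexive relation such that for distinct vertices exactly one of
`r x y`, `r y x` holds. -/
def IsTournament {V : Type} (r : V → V → Prop) : Prop :=
  (∀ x, ¬ r x x) ∧ ∀ x y : V, x ≠ y → (r x y ↔ ¬ r y x)

/-- The transitive tournament on 4 vertices. -/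
def T4rel : Fin 4 → Fin 4 → Prop := fun i j => i < j

/-- The unique strongly connected tournament on 4 vertices. -/
def C4rel : Fin 4 → Fin 4 → Prop := fun i j =>
  (i = 0 ∧ j = 1) ∨ (i = 1 ∧ j = 2) ∨ (i = 2 ∧ j = 3) ∨ (i = 3 ∧ j = 0) ∨
  (i = 0 ∧ j = 2) ∨ (i = 1 ∧ j = 3)

/-- The 4-vertex tournament in which a cyclic triangle beats a fourth vertex. -/
def W4rel : Fin 4 → Fin 4 → Prop := fun i j =>
  (i = 0 ∧ j = 1) ∨ (i = 1 ∧ j = 2) ∨ (i = 2 ∧ j = 0) ∨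
  (i = 0 ∧ j = 3) ∨ (i = 1 ∧ j = 3) ∨ (i = 2 ∧ j = 3)

/-- The 4-vertex tournament in which one vertex beats a cyclic triangle. -/
def L4rel : Fin 4 → Fin 4 → Prop := fun i j =>
  (i = 0 ∧ j = 1) ∨ (i = 1 ∧ j = 2) ∨ (i = 2 ∧ j = 0) ∨
  (i = 3 ∧ j = 0) ∨ (i = 3 ∧ j = 1) ∨ (i = 3 ∧ j = 2)

/-- The cyclic triangle (directed 3-cycle). -/
def C3rel : Fin 3 → Fin 3 → Prop := fun i j =>
  (i = 0 ∧ j = 1) ∨ (i = 1 ∧ j = 2) ∨ (i = 2 ∧ j = 0)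

/-- `s` induces a subtournament isomorphic to the pattern `m`. -/
def InducesPattern {V : Type} {k : ℕ} (r : V → V → Prop) (m : Fin k → Fin k → Prop)
    (s : Finset V) : Prop :=
  ∃ f : Fin k → V, Function.Injective f ∧ Set.range f = (s : Set V) ∧
    ∀ i j : Fin k, m i j ↔ r (f i) (f j)

-- the number of `k`-element vertex subsets inducing a copy of the pattern `m`
open Classical in
noncomputable def patternCount {V : Type} [Fintype V] {k : ℕ} (r : V → V → Prop)
    (m : Fin k → Fin k → Prop) : ℕ :=
  (((univ : Finset V).powersetCard k).filter (fun s => InducesPattern r m s)).card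

-- the probability that a uniformly random `k`-element vertex subset induces a copy of `m`
noncomputable def patternDensity {V : Type} [Fintype V] {k : ℕ} (r : V → V → Prop)
    (m : Fin k → Fin k → Prop) : ℝ :=
  (patternCount r m : ℝ) / ((Fintype.card V).choose k)

/-- The circular tournament on `n` vertices (for odd `n`): `i → j` iff the clockwise
distance from `i` to `j` is between `1` and `(n-1)/2`. -/
def circRel (n : ℕ) : Fin n → Fin n → Prop := fun i j =>
  1 ≤ (j.val + n - i.val) % n ∧ (j.val + n - i.val) % n ≤ (n - 1) / 2

instance decT4 : ∀ i j, Decidable (T4rel i j) := fun i j => by unfold T4rel; infer_instance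
instance decC4 : ∀ i j, Decidable (C4rel i j) := fun i j => by unfold C4rel; infer_instance

/-- The 4-vertex tournament encoded by six Booleans. -/
def bmat (a b c d e f : Bool) : Fin 4 → Fin 4 → Bool :=
  ![![false, a, b, c], ![!a, false, d, e], ![!b, !d, false, f], ![!c, !e, !f, false]]

theorem bool_id : ∀ a b c d e f : Bool,
    (if ∃ σ : Equiv.Perm (Fin 4), ∀ i j, T4rel i j ↔ bmat a b c d e f (σ i) (σ j) = true
      then (1 : ℤ) else 0) -
    (if ∃ σ : Equiv.Perm (Fin 4), ∀ i j, C4rel i j ↔ bmat a b c d e f (σ i) (σ j) = true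
      then (1 : ℤ) else 0) =
    (∑ i, (((univ.filter (fun j => bmat a b c d e f i j = true)).card.choose 2 : ℕ) : ℤ)) - 3 := by
  decide +kernel

theorem bool_ex : ∀ a b c d e f : Bool,
    (∃ σ : Equiv.Perm (Fin 4), ∀ i j, T4rel i j ↔ bmat a b c d e f (σ i) (σ j) = true) ∨
    (∃ σ : Equiv.Perm (Fin 4), ∀ i j, C4rel i j ↔ bmat a b c d e f (σ i) (σ j) = true) ∨
    ∃ x y z w, bmat a b c d e f x y = true ∧ bmat a b c d e f y z = true ∧
      bmat a b c d e f z x = true ∧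
      ((bmat a b c d e f w x = true ∧ bmat a b c d e f w y = true ∧ bmat a b c d e f w z = true) ∨
      (bmat a b c d e f x w = true ∧ bmat a b c d e f y w = true ∧ bmat a b c d e f z w = true)) := by
  decide +kernel

theorem bool_not_both : ∀ a b c d e f : Bool,
    ¬ ((∃ σ : Equiv.Perm (Fin 4), ∀ i j, T4rel i j ↔ bmat a b c d e f (σ i) (σ j) = true) ∧
    (∃ σ : Equiv.Perm (Fin 4), ∀ i j, C4rel i j ↔ bmat a b c d e f (σ i) (σ j) = true)) := by
  decide +kernel

theorem induces_iff {V : Type} (r : V → V → Prop) (m : Fin 4 → Fin 4 → Prop) (s : Finset V)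
    (e : Fin 4 → V) (he : Function.Injective e) (hs : Set.range e = (s : Set V)) :
    InducesPattern r m s ↔ ∃ σ : Equiv.Perm (Fin 4), ∀ i j, m i j ↔ r (e (σ i)) (e (σ j)) := by
  constructor
  · rintro ⟨f, hf, hfs, h⟩
    have : ∀ i, ∃ k, e k = f i := fun i => by
      have : f i ∈ Set.range e := by rw [hs, ← hfs]; exact ⟨i, rfl⟩
      exact this
    choose g hg using this
    have hgi : Function.Injective g := fun i j hij => hf (by rw [← hg, ← hg, hij])
    refine ⟨Equiv.ofBijective g (Finite.injective_iff_bijective.1 hgi), fun i j => ?_⟩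
    simp only [Equiv.ofBijective_apply, hg]
    exact h i j
  · rintro ⟨σ, h⟩
    refine ⟨e ∘ σ, he.comp σ.injective, ?_, h⟩
    rw [σ.surjective.range_comp, hs]

theorem exists_enum {V : Type} (s : Finset V) (h : s.card = 4) :
    ∃ e : Fin 4 → V, Function.Injective e ∧ Set.range e = (s : Set V) := by
  refine ⟨fun i => ((s.equivFinOfCardEq h).symm i : V), ?_, ?_⟩
  · exact Subtype.val_injective.comp (Equiv.injective _)
  · have := (s.equivFinOfCardEq h).symm.surjective.range_comp (Subtype.val : s → V)
    simpa [Function.comp_def] using this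

theorem exists_bmat {V : Type} (r : V → V → Prop) (hr : IsTournament r)
    (e : Fin 4 → V) (he : Function.Injective e) :
    ∃ a b c d f g : Bool, ∀ i j, r (e i) (e j) ↔ bmat a b c d f g i j = true := by
  classical
  refine ⟨decide (r (e 0) (e 1)), decide (r (e 0) (e 2)), decide (r (e 0) (e 3)),
    decide (r (e 1) (e 2)), decide (r (e 1) (e 3)), decide (r (e 2) (e 3)), ?_⟩
  have h1 : ∀ i j, i ≠ j → (r (e i) (e j) ↔ ¬ r (e j) (e i)) :=
    fun i j hij => hr.2 _ _ (fun h => hij (he h))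
  have h10 := h1 1 0 (by decide)
  have h20 := h1 2 0 (by decide)
  have h30 := h1 3 0 (by decide)
  have h21 := h1 2 1 (by decide)
  have h31 := h1 3 1 (by decide)
  have h32 := h1 3 2 (by decide)
  intro i j
  fin_cases i <;> fin_cases j <;> simp [bmat, hr.1, h10, h20, h30, h21, h31, h32]

open Classical in
theorem set_id {V : Type} (r : V → V → Prop) (hr : IsTournament r) (s : Finset V)
    (h : s.card = 4) :
    (if InducesPattern r T4rel s then (1 : ℤ) else 0) -
      (if InducesPattern r C4rel s then (1 : ℤ) else 0) =
    (∑ v ∈ s, (((s.filter (fun w => r v w)).card.choose 2 : ℕ) : ℤ)) - 3 := by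
  obtain ⟨e, he, hs⟩ := exists_enum s h
  obtain ⟨a, b, c, d, f, g, hb⟩ := exists_bmat r hr e he
  have hs' : s = univ.map ⟨e, he⟩ := by
    ext x
    have : x ∈ Set.range e ↔ x ∈ (s : Set V) := by rw [hs]
    simpa using this.symm
  have key := bool_id a b c d f g
  simp only [induces_iff r _ s e he hs, hb]
  have hsum : (∑ v ∈ s, (((s.filter (fun w => r v w)).card.choose 2 : ℕ) : ℤ)) =
      ∑ i, (((univ.filter (fun j => bmat a b c d f g i j = true)).card.choose 2 : ℕ) : ℤ) := by
    rw [hs', sum_map]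
    refine sum_congr rfl fun i _ => ?_
    rw [filter_map, card_map]
    simp only [Function.comp_def, Function.Embedding.coeFn_mk, hb]
  rw [hsum, ← key]

open Classical in
theorem card_supersets {V : Type} [Fintype V] (t : Finset V) (ht : t.card = 3) :
    (((univ : Finset V).powersetCard 4).filter (fun s => t ⊆ s)).card = Fintype.card V - 3 := by
  have : ((univ : Finset V).powersetCard 4).filter (fun s => t ⊆ s) =
      (tᶜ).image (fun w => insert w t) := by
    ext s
    simp only [mem_filter, mem_powersetCard, subset_univ, true_and, mem_image, mem_compl]
    constructor
    · rintro ⟨h4, hts⟩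
      have h1 : (s \ t).card = 1 := by rw [card_sdiff_of_subset hts]; omega
      obtain ⟨w, hw⟩ := card_eq_one.1 h1
      have hw' : w ∈ s \ t := by rw [hw]; simp
      refine ⟨w, (mem_sdiff.1 hw').2, ?_⟩
      rw [← sdiff_union_of_subset hts, hw]; rfl
    · rintro ⟨w, hw, rfl⟩
      exact ⟨by rw [card_insert_of_notMem hw, ht], subset_insert _ _⟩
  rw [this, card_image_of_injOn, card_compl, ht]
  intro x hx y hy hxy
  have hxy : insert x t = insert y t := hxy
  have hx : x ∉ t := by simpa using hx
  have : x ∈ insert y t := by rw [← hxy]; simp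
  rcases mem_insert.1 this with h | h
  · exact h
  · exact absurd h hx

open Classical in
theorem double_count {V : Type} [Fintype V] (r : V → V → Prop) (hr : IsTournament r) :
    ∑ s ∈ (univ : Finset V).powersetCard 4, ∑ v ∈ s, (s.filter (fun w => r v w)).card.choose 2 =
    (∑ v, (univ.filter (fun w => r v w)).card.choose 2) * (Fintype.card V - 3) := by
  have h1 : ∀ s ∈ (univ : Finset V).powersetCard 4,
      ∑ v ∈ s, (s.filter (fun w => r v w)).card.choose 2 =
      ∑ v, ∑ p ∈ (univ.filter (fun w => r v w)).powersetCard 2, if insert v p ⊆ s then 1 else 0 := by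
    intro s _
    rw [← sum_filter_add_sum_filter_not univ (fun v => v ∈ s)]
    rw [sum_eq_zero (s := univ.filter (fun v => ¬ v ∈ s)), add_zero]
    · have : univ.filter (fun v => v ∈ s) = s := by ext; simp
      rw [this]
      refine sum_congr rfl fun v hv => ?_
      rw [← card_powersetCard, ← card_filter]
      congr 1
      ext p
      rw [mem_filter, insert_subset_iff]
      simp only [mem_powersetCard, mem_filter, hv, true_and, subset_iff, mem_univ]
      constructor
      · rintro ⟨h, h'⟩
        exact ⟨⟨fun x hx => (h hx).2, h'⟩, fun x hx => (h hx).1⟩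
      · rintro ⟨⟨h, h'⟩, h2⟩
        exact ⟨fun x hx => ⟨h2 hx, h hx⟩, h'⟩
    · intro v hv
      refine sum_eq_zero fun p _ => ?_
      rw [if_neg]
      intro h
      exact (mem_filter.1 hv).2 (h (mem_insert_self _ _))
  rw [sum_congr rfl h1, sum_comm, sum_mul]
  refine sum_congr rfl fun v _ => ?_
  rw [sum_comm]
  have : ∀ p ∈ (univ.filter (fun w => r v w)).powersetCard 2,
      (∑ s ∈ (univ : Finset V).powersetCard 4, if insert v p ⊆ s then 1 else 0) =
      Fintype.card V - 3 := by
    intro p hp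
    rw [mem_powersetCard] at hp
    rw [← card_filter, card_supersets]
    rw [card_insert_of_notMem, hp.2]
    intro hv
    exact hr.1 v (mem_filter.1 (hp.1 hv)).2
  rw [sum_congr rfl this, sum_const, card_powersetCard, smul_eq_mul]

open Classical in
theorem count_id {V : Type} [Fintype V] (r : V → V → Prop) (hr : IsTournament r) :
    (patternCount r T4rel : ℤ) - patternCount r C4rel =
    ((∑ v, (univ.filter (fun w => r v w)).card.choose 2) * (Fintype.card V - 3) : ℕ) -
      3 * ((Fintype.card V).choose 4 : ℤ) := by
  unfold patternCount
  rw [card_filter, card_filter, ← double_count r hr]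
  push_cast
  rw [← sum_sub_distrib, sum_congr rfl fun s hs => set_id r hr s (mem_powersetCard.1 hs).2]
  rw [sum_sub_distrib, sum_const, card_powersetCard]
  simp [mul_comm]

open Classical in
theorem sum_deg {V : Type} [Fintype V] (r : V → V → Prop) (hr : IsTournament r) :
    2 * ∑ v, (univ.filter (fun w => r v w)).card = Fintype.card V * (Fintype.card V - 1) := by
  have h1 : ∑ v, (univ.filter (fun w => r v w)).card = ∑ v, (univ.filter (fun w => r w v)).card := by
    simp only [card_filter]
    rw [sum_comm]
  have h2 : ∀ v, (univ.filter (fun w => r v w)).card + (univ.filter (fun w => r w v)).card =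
      Fintype.card V - 1 := by
    intro v
    rw [← card_union_of_disjoint]
    · rw [← card_univ, ← card_erase_of_mem (mem_univ v)]
      congr 1
      ext w
      simp only [mem_union, mem_filter, mem_univ, true_and, mem_erase, and_true]
      constructor
      · rintro h rfl
        exact hr.1 w (by tauto)
      · intro h
        have := hr.2 v w (Ne.symm h)
        tauto
    · rw [disjoint_filter]
      intro w _ h h'
      by_cases hvw : v = w
      · subst hvw; exact hr.1 _ h
      · exact ((hr.2 v w hvw).1 h) h'
  rw [two_mul]
  nth_rw 2 [h1]
  rw [← sum_add_distrib, sum_congr rfl fun v _ => h2 v]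
  simp

theorem choose4 (n : ℕ) (hn : 4 ≤ n) :
    ((n.choose 4 : ℕ) : ℝ) = (n : ℝ) * (n - 1) * (n - 2) * (n - 3) / 24 := by
  rw [Nat.cast_choose_eq_ascPochhammer_div]
  obtain ⟨k, rfl⟩ := Nat.exists_eq_add_of_le hn
  have : 4 + k - (4 - 1) = k + 1 := by omega
  rw [this]
  simp [ascPochhammer_succ_right, Nat.factorial]
  ring

/-- The difference of densities, in terms of the out-degrees. -/
theorem density_diff {V : Type} [Fintype V] (r : V → V → Prop) (hr : IsTournament r)
    (hn : 4 ≤ Fintype.card V) (S : ℝ)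
    (hS : S = ∑ v, (((@Finset.filter V (fun w => r v w) (Classical.decPred _) univ).card.choose 2 : ℕ) : ℝ)) :
    patternDensity r T4rel - patternDensity r C4rel =
    S * (Fintype.card V - 3) / ((Fintype.card V).choose 4) - 3 := by
  have h := count_id r hr
  have h' : (patternCount r T4rel : ℝ) - patternCount r C4rel =
      S * (Fintype.card V - 3) - 3 * ((Fintype.card V).choose 4 : ℝ) := by
    have h2 := congrArg (Int.cast : ℤ → ℝ) h
    push_cast [Nat.cast_sub (show 3 ≤ Fintype.card V by omega)] at h2
    rw [h2, hS]
  have hc : (((Fintype.card V).choose 4 : ℕ) : ℝ) ≠ 0 := by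
    have := Nat.choose_pos hn
    positivity
  unfold patternDensity
  rw [← sub_div, h', sub_div, mul_div_cancel_right₀ _ hc]

theorem part1 {V : Type} [Fintype V] (r : V → V → Prop) (hr : IsTournament r)
    (hn : 4 ≤ Fintype.card V) :
    patternDensity r C4rel ≤ patternDensity r T4rel + 3 / ((Fintype.card V : ℝ) - 2) := by
  classical
  have h := density_diff r hr hn _ rfl
  set d : V → ℕ := fun v => (@Finset.filter V (fun w => r v w) (Classical.decPred _) univ).card with hd
  set S : ℝ := ∑ v, (((d v).choose 2 : ℕ) : ℝ) with hS
  set n := Fintype.card V with hnn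
  have hsum : 2 * ∑ v, (d v : ℝ) = n * (n - 1) := by
    have := congrArg (Nat.cast : ℕ → ℝ) (sum_deg r hr)
    push_cast [Nat.cast_sub (show 1 ≤ Fintype.card V by omega)] at this
    rw [← this]
  have h4 : (4 : ℝ) ≤ n := by exact_mod_cast hn
  have hlow : (n : ℝ) * (n - 1) * (n - 3) / 8 ≤ S := by
    have hp : ∀ v, ((n : ℝ) / 2 - 1) * d v - ((n : ℝ) - 1) ^ 2 / 8 ≤ (((d v).choose 2 : ℕ) : ℝ) := by
      intro v
      rw [Nat.cast_choose_two]
      nlinarith [sq_nonneg ((d v : ℝ) - (n - 1) / 2)]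
    have := sum_le_sum (s := univ) fun v _ => hp v
    rw [sum_sub_distrib, ← mul_sum, sum_const, card_univ, nsmul_eq_mul] at this
    have h3 : ∑ v, (d v : ℝ) = n * (n - 1) / 2 := by linarith
    rw [h3] at this
    refine le_trans (le_of_eq ?_) this
    ring
  rw [choose4 n hn] at h
  have h5 : (3 : ℝ) - 3 / (n - 2) ≤ S * (n - 3) / ((n : ℝ) * (n - 1) * (n - 2) * (n - 3) / 24) := by
    have e1 : (0 : ℝ) < n - 3 := by linarith
    have e2 : (0 : ℝ) < n - 2 := by linarith
    have e3 : (0 : ℝ) < n - 1 := by linarith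
    have e4 : (0 : ℝ) < n := by linarith
    rw [le_div_iff₀ (by positivity)]
    refine le_trans (le_of_eq ?_) (mul_le_mul_of_nonneg_right hlow e1.le)
    field_simp
    ring
  linarith

theorem circ_iff (h : ℕ) (i j : Fin (2 * h + 1)) : circRel (2 * h + 1) i j ↔
    (i.val < j.val ∧ j.val ≤ i.val + h) ∨ (j.val + h < i.val) := by
  unfold circRel
  have hi := i.2
  have hj := j.2
  have e : (2 * h + 1 - 1) / 2 = h := by omega
  rw [e]
  rcases Nat.lt_or_ge j.val i.val with hlt | hge
  · rw [Nat.mod_eq_of_lt (by omega)]; omega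
  · have : j.val + (2 * h + 1) - i.val = (j.val - i.val) + (2 * h + 1) := by omega
    rw [this, Nat.add_mod_right, Nat.mod_eq_of_lt (by omega)]; omega

theorem circ_tournament (h : ℕ) : IsTournament (circRel (2 * h + 1)) := by
  constructor
  · intro x; rw [circ_iff]; omega
  · intro x y hxy
    rw [circ_iff, circ_iff]
    have := fun e => hxy (Fin.ext e)
    omega

theorem circ_deg (h : ℕ) (v : Fin (2 * h + 1)) :
    (@Finset.filter _ (fun w => circRel (2 * h + 1) v w) (Classical.decPred _) univ).card = h := by
  have hv := v.2
  have : (@Finset.filter _ (fun w => circRel (2 * h + 1) v w) (Classical.decPred _) univ).map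
      Fin.valEmbedding = Ioc v.val (min (v.val + h) (2 * h)) ∪ range (v.val - h) := by
    ext x
    simp only [mem_map, mem_filter, mem_univ, true_and, circ_iff, Fin.valEmbedding_apply,
      mem_union, mem_Ioc, mem_range]
    constructor
    · rintro ⟨a, ha, rfl⟩
      have := a.2
      omega
    · intro hx
      exact ⟨⟨x, by omega⟩, by simp only; omega, rfl⟩
  rw [← card_map Fin.valEmbedding, this, card_union_of_disjoint, Nat.card_Ioc, card_range]
  · omega
  · rw [disjoint_left]
    intro x
    simp only [mem_Ioc, mem_range]
    omega

theorem circ_sum (h : ℕ) (hn : 2 ≤ h) :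
    patternDensity (circRel (2 * h + 1)) T4rel + patternDensity (circRel (2 * h + 1)) C4rel = 1 := by
  classical
  have key : patternCount (circRel (2 * h + 1)) T4rel + patternCount (circRel (2 * h + 1)) C4rel =
      (2 * h + 1).choose 4 := by
    unfold patternCount
    rw [← card_union_of_disjoint]
    · rw [← filter_or, filter_true_of_mem, card_powersetCard]
      · simp
      · intro s hs
        obtain ⟨e, he, hse⟩ := exists_enum s (mem_powersetCard.1 hs).2
        obtain ⟨a, b, c, d, f, g, hb⟩ := exists_bmat _ (circ_tournament h) e he
        rw [induces_iff _ _ s e he hse, induces_iff _ _ s e he hse]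
        simp only [hb]
        rcases bool_ex a b c d f g with h1 | h1 | ⟨x, y, z, w, h1⟩
        · exact Or.inl h1
        · exact Or.inr h1
        · exfalso
          simp only [← hb, circ_iff] at h1
          have := (e x).2
          have := (e y).2
          have := (e z).2
          have := (e w).2
          omega
    · rw [disjoint_filter]
      intro s hs h1 h2
      obtain ⟨e, he, hse⟩ := exists_enum s (mem_powersetCard.1 hs).2
      obtain ⟨a, b, c, d, f, g, hb⟩ := exists_bmat _ (circ_tournament h) e he
      rw [induces_iff _ _ s e he hse] at h1 h2
      simp only [hb] at h1 h2
      exact bool_not_both a b c d f g ⟨h1, h2⟩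
  unfold patternDensity
  rw [← add_div, Fintype.card_fin]
  have hc := Nat.choose_pos (show 4 ≤ 2 * h + 1 by omega)
  rw [div_eq_one_iff_eq (by positivity)]
  exact_mod_cast key

theorem circ_diff (h : ℕ) (hn : 2 ≤ h) :
    patternDensity (circRel (2 * h + 1)) T4rel - patternDensity (circRel (2 * h + 1)) C4rel =
      - (3 / (2 * h - 1)) := by
  rw [density_diff _ (circ_tournament h) (by simp; omega) _ rfl]
  simp only [circ_deg, Fintype.card_fin]
  rw [choose4 _ (by omega), Nat.cast_choose_two, sum_const, card_univ, Fintype.card_fin,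
    nsmul_eq_mul]
  have h2 : (2 : ℝ) ≤ h := by exact_mod_cast hn
  have e1 : (2 : ℝ) * h - 1 ≠ 0 := by intro; linarith
  have e2 : (h : ℝ) - 1 ≠ 0 := by intro; linarith
  have e3 : (h : ℝ) ≠ 0 := by intro; linarith
  have e4 : (2 : ℝ) * h + 1 ≠ 0 := by intro; linarith
  push_cast
  have f1 : (2 : ℝ) * h + 1 - 1 = 2 * h := by ring
  have f2 : (2 : ℝ) * h + 1 - 2 = 2 * h - 1 := by ring
  have f3 : (2 : ℝ) * h + 1 - 3 = 2 * (h - 1) := by ring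
  rw [f1, f2, f3]
  field_simp
  ring

/-- Every large tournament satisfies `c₄ ≤ t₄ + ε`; this is tight since the circular
tournaments have `t₄ = c₄ = 1/2` in the limit. -/
theorem c4_le_t4 :
    (∀ ε : ℝ, 0 < ε → ∃ N : ℕ, ∀ (V : Type) [Fintype V] (r : V → V → Prop),
      IsTournament r → N ≤ Fintype.card V →
      patternDensity r C4rel ≤ patternDensity r T4rel + ε) ∧
    ∀ ε : ℝ, 0 < ε → ∃ N : ℕ, ∀ n : ℕ, Odd n → N ≤ n →
      |patternDensity (circRel n) T4rel - 1 / 2| ≤ ε ∧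
      |patternDensity (circRel n) C4rel - 1 / 2| ≤ ε := by
  constructor
  · intro ε hε
    obtain ⟨N, hN⟩ := exists_nat_gt (3 / ε)
    refine ⟨N + 4, fun V _ r hr hV => ?_⟩
    refine (part1 r hr (by omega)).trans ?_
    have hV' : (N : ℝ) + 4 ≤ Fintype.card V := by exact_mod_cast hV
    have hp : 0 < 3 / ε := by positivity
    have : 3 / ((Fintype.card V : ℝ) - 2) ≤ ε := by
      rw [div_le_comm₀ (by linarith) hε]
      linarith
    linarith
  · intro ε hε
    obtain ⟨N, hN⟩ := exists_nat_gt (3 / ε)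
    refine ⟨N + 5, fun n hodd hn => ?_⟩
    obtain ⟨h, rfl⟩ := hodd
    have h1 := circ_sum h (by omega)
    have h2 := circ_diff h (by omega)
    have hV' : (N : ℝ) + 5 ≤ 2 * h + 1 := by exact_mod_cast hn
    have hp : 0 < 3 / ε := by positivity
    have h3 : 3 / (2 * (h : ℝ) - 1) ≤ ε := by
      rw [div_le_comm₀ (by linarith) hε]
      linarith
    have h4 : 0 < 3 / (2 * (h : ℝ) - 1) := div_pos (by norm_num) (by linarith)
    constructor <;> rw [abs_le] <;> constructor <;> linarith
end

section
/- Let T be a tournament on n ≥ 2 vertices, let m be its number of cyclic triangles and let q be its number of 4-element vertex subsets inducing C₄. Then 2·q·binom(n,2) ≥ 9m² − 3m·binom(n,2). Consequently, for every ε > 0 there is N such that every tournament on n ≥ N vertices satisfies c₄ ≥ 6c₃² − ε. -/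
open Finset

section Helpers
open Classical

variable {V : Type} [Fintype V]

noncomputable def edgesF (r : V → V → Prop) : Finset (V × V) :=
  univ.filter (fun e => r e.1 e.2)

noncomputable def apex (r : V → V → Prop) (e : V × V) : Finset V :=
  univ.filter (fun z => r e.2 z ∧ r z e.1)

noncomputable def pairsF (r : V → V → Prop) (e : V × V) : Finset (V × V) :=
  (apex r e ×ˢ apex r e).filter (fun p => r p.1 p.2)

lemma tour_asymm {r : V → V → Prop} (h : IsTournament r) {x y : V} (hxy : r x y) : ¬ r y x := by
  by_cases e : x = y
  · subst e; exact absurd hxy (h.1 x)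
  · exact (h.2 x y e).1 hxy

lemma card_edges_le {r : V → V → Prop} (h : IsTournament r) :
    (edgesF r).card ≤ (Fintype.card V).choose 2 := by
  rw [← Finset.card_univ, ← Finset.card_powersetCard]
  apply Finset.card_le_card_of_injOn (fun e : V × V => ({e.1, e.2} : Finset V))
  · rintro ⟨x, y⟩ he
    simp only [edgesF, coe_filter, mem_univ, true_and, Set.mem_ofPred_eq] at he
    have hne : x ≠ y := by rintro rfl; exact h.1 _ he
    simp [Finset.mem_powersetCard, Finset.card_pair hne]
  · rintro ⟨x, y⟩ he ⟨x', y'⟩ he' hE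
    simp only [edgesF, coe_filter, mem_univ, true_and, Set.mem_ofPred_eq] at he he'
    have hne : x ≠ y := by rintro rfl; exact h.1 _ he
    have as := tour_asymm h he
    simp only at hE
    have h1 : x ∈ ({x', y'} : Finset V) := by rw [← hE]; simp
    have h2 : y ∈ ({x', y'} : Finset V) := by rw [← hE]; simp
    simp only [mem_insert, mem_singleton] at h1 h2
    grind

lemma apex_sq {r : V → V → Prop} (h : IsTournament r) (e : V × V) :
    (apex r e).card ^ 2 ≤ (apex r e).card + 2 * (pairsF r e).card := by
  rw [sq, ← Finset.card_product]
  have hs : apex r e ×ˢ apex r e ⊆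
      ((apex r e).image (fun z => (z, z)) ∪ pairsF r e) ∪ (pairsF r e).image Prod.swap := by
    rintro ⟨z, w⟩ hz
    have hz' := Finset.mem_product.1 hz
    simp only [mem_union, mem_image, pairsF, mem_filter, mem_product, Prod.exists, Prod.swap,
      Prod.mk.injEq]
    by_cases hzw : z = w
    · subst hzw; exact Or.inl (Or.inl ⟨z, hz'.1, rfl, rfl⟩)
    · by_cases hr : r z w
      · exact Or.inl (Or.inr ⟨hz', hr⟩)
      · exact Or.inr ⟨w, z, ⟨⟨hz'.2, hz'.1⟩, (h.2 w z (Ne.symm hzw)).2 hr⟩, rfl, rfl⟩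
  have h1 := Finset.card_le_card hs
  have h2 := Finset.card_union_le ((apex r e).image (fun z => (z, z)) ∪ pairsF r e)
    ((pairsF r e).image Prod.swap)
  have h3 := Finset.card_union_le ((apex r e).image (fun z => (z, z))) (pairsF r e)
  have h4 : ((apex r e).image (fun z => (z, z))).card ≤ _ := Finset.card_image_le
  have h5 : ((pairsF r e).image Prod.swap).card ≤ _ := Finset.card_image_le
  omega

lemma pairs_le {r : V → V → Prop} (h : IsTournament r) :
    ∑ e ∈ edgesF r, (pairsF r e).card ≤ patternCount r C4rel := by
  rw [← Finset.card_sigma]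
  unfold patternCount
  have key : ∀ p ∈ (edgesF r).sigma (fun e => pairsF r e),
      r p.1.1 p.1.2 ∧ r p.1.2 p.2.1 ∧ r p.1.2 p.2.2 ∧ r p.2.1 p.1.1 ∧ r p.2.2 p.1.1 ∧
      r p.2.1 p.2.2 := by
    intro p hp
    simp only [mem_sigma, edgesF, pairsF, apex, mem_filter, mem_univ, true_and, mem_product] at hp
    tauto
  apply Finset.card_le_card_of_injOn
    (fun p : (_ : V × V) × (V × V) => ({p.1.2, p.2.1, p.2.2, p.1.1} : Finset V))
  · rintro ⟨⟨x, y⟩, ⟨z, w⟩⟩ hp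
    obtain ⟨h1, h2, h3, h4, h5, h6⟩ := key _ hp
    simp only at h1 h2 h3 h4 h5 h6
    have a1 := tour_asymm h h1
    have a2 := tour_asymm h h2
    have a3 := tour_asymm h h3
    have a4 := tour_asymm h h4
    have a5 := tour_asymm h h5
    have a6 := tour_asymm h h6
    have n1 : x ≠ y := by rintro rfl; contradiction
    have n2 : y ≠ z := by rintro rfl; contradiction
    have n3 : y ≠ w := by rintro rfl; contradiction
    have n4 : z ≠ x := by rintro rfl; contradiction
    have n5 : w ≠ x := by rintro rfl; contradiction
    have n6 : z ≠ w := by rintro rfl; contradiction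
    have ix := h.1 x
    have iy := h.1 y
    have iz := h.1 z
    have iw := h.1 w
    simp only [coe_filter, Set.mem_ofPred_eq, mem_powersetCard, subset_univ, true_and]
    refine ⟨?_, ![y, z, w, x], ?_, ?_, ?_⟩
    · rw [card_insert_of_notMem, card_insert_of_notMem, card_insert_of_notMem, card_singleton] <;>
        simp [*, n1.symm]
    · intro i j
      fin_cases i <;> fin_cases j <;> simp [*, n1.symm, n2.symm, n3.symm, n4.symm, n5.symm, n6.symm]
    · ext v
      simp [eq_comm]
      tauto
    · intro i j
      fin_cases i <;> fin_cases j <;> simp [C4rel, *]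
  · rintro ⟨⟨x, y⟩, ⟨z, w⟩⟩ hp ⟨⟨x', y'⟩, ⟨z', w'⟩⟩ hp' hE
    obtain ⟨h1, h2, h3, h4, h5, h6⟩ := key _ hp
    obtain ⟨k1, k2, k3, k4, k5, k6⟩ := key _ hp'
    simp only at h1 h2 h3 h4 h5 h6 k1 k2 k3 k4 k5 k6 hE
    have a1 := tour_asymm h h1
    have a2 := tour_asymm h h2
    have a3 := tour_asymm h h3
    have a4 := tour_asymm h h4
    have a5 := tour_asymm h h5
    have a6 := tour_asymm h h6
    have ix := h.1 x
    have iy := h.1 y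
    have iz := h.1 z
    have iw := h.1 w
    have m1 : x' ∈ ({y, z, w, x} : Finset V) := by rw [hE]; simp
    have m2 : y' ∈ ({y, z, w, x} : Finset V) := by rw [hE]; simp
    have m3 : z' ∈ ({y, z, w, x} : Finset V) := by rw [hE]; simp
    have m4 : w' ∈ ({y, z, w, x} : Finset V) := by rw [hE]; simp
    clear hE hp hp' key
    simp only [mem_insert, mem_singleton] at m1 m2 m3 m4
    rcases m1 with rfl | rfl | rfl | rfl <;> rcases m2 with rfl | rfl | rfl | rfl <;>
      first
      | contradiction
      | (rcases m3 with rfl | rfl | rfl | rfl <;> first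
          | contradiction
          | (rcases m4 with rfl | rfl | rfl | rfl <;> first | contradiction | rfl))

lemma count_le {r : V → V → Prop} :
    patternCount r C3rel ≤ (Fintype.card V).choose 3 := by
  unfold patternCount
  refine (Finset.card_filter_le _ _).trans ?_
  rw [Finset.card_powersetCard, Finset.card_univ]

lemma three_m_le {r : V → V → Prop} (h : IsTournament r) :
    3 * patternCount r C3rel ≤ ∑ e ∈ edgesF r, (apex r e).card := by
  rcases isEmpty_or_nonempty V with hV | hV
  · have := count_le (r := r)
    simp at this
    simp [this]
  rw [← Finset.card_sigma]
  unfold patternCount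
  set M := ((univ : Finset V).powersetCard 3).filter (fun s => InducesPattern r C3rel s) with hM
  have hex : ∀ s : Finset V, ∃ f : Fin 3 → V, s ∈ M →
      Function.Injective f ∧ Set.range f = (s : Set V) ∧
        ∀ i j : Fin 3, C3rel i j ↔ r (f i) (f j) := by
    intro s
    by_cases hs : s ∈ M
    · obtain ⟨f, hf⟩ := (Finset.mem_filter.1 hs).2
      exact ⟨f, fun _ => hf⟩
    · exact ⟨fun _ => hV.some, fun h => absurd h hs⟩
  choose f hf using hex
  have : 3 * M.card = ((univ : Finset (Fin 3)) ×ˢ M).card := by simp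
  rw [this]
  apply Finset.card_le_card_of_injOn
    (fun p : Fin 3 × Finset V => (⟨(f p.2 p.1, f p.2 (p.1 + 1)), f p.2 (p.1 + 2)⟩ :
      (_ : V × V) × V))
  · rintro ⟨i, s⟩ hp
    have hs : s ∈ M := by simpa using hp
    obtain ⟨-, -, h3⟩ := hf s hs
    simp only [coe_sigma, Set.mem_sigma_iff, mem_coe, edgesF, apex, mem_filter, mem_univ, true_and,
      ← h3]
    fin_cases i <;> simp [C3rel]
  · rintro ⟨i, s⟩ hp ⟨j, t⟩ hq hE
    have hs : s ∈ M := by simpa using hp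
    have ht : t ∈ M := by simpa using hq
    simp only [Sigma.mk.injEq, Prod.mk.injEq, heq_eq_eq] at hE
    obtain ⟨⟨e1, e2⟩, e3⟩ := hE
    obtain ⟨a1, a2, -⟩ := hf s hs
    obtain ⟨b1, b2, -⟩ := hf t ht
    have cov : ∀ i k : Fin 3, k = i ∨ k = i + 1 ∨ k = i + 2 := by decide
    have hst : s = t := by
      apply Finset.coe_injective
      rw [← a2, ← b2]
      ext v
      constructor
      · rintro ⟨k, rfl⟩
        rcases cov i k with rfl | rfl | rfl
        · exact ⟨_, e1.symm⟩
        · exact ⟨_, e2.symm⟩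
        · exact ⟨_, e3.symm⟩
      · rintro ⟨k, rfl⟩
        rcases cov j k with rfl | rfl | rfl
        · exact ⟨_, e1⟩
        · exact ⟨_, e2⟩
        · exact ⟨_, e3⟩
    subst hst
    rw [a1 e1]

lemma main_ineq {r : V → V → Prop} (h : IsTournament r) :
    9 * (patternCount r C3rel : ℤ) ^ 2 -
          3 * (patternCount r C3rel : ℤ) * ((Fintype.card V).choose 2) ≤
        2 * (patternCount r C4rel : ℤ) * ((Fintype.card V).choose 2) := by
  have h1 := card_edges_le h
  have h2 : ∑ e ∈ edgesF r, (apex r e).card ^ 2 ≤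
      ∑ e ∈ edgesF r, ((apex r e).card + 2 * (pairsF r e).card) :=
    Finset.sum_le_sum (fun e _ => apex_sq h e)
  rw [Finset.sum_add_distrib, ← Finset.mul_sum] at h2
  have h3 := pairs_le h
  have h4 := three_m_le h
  have h5 := sq_sum_le_card_mul_sum_sq (s := edgesF r) (f := fun e => (apex r e).card)
  set S := ∑ e ∈ edgesF r, (apex r e).card
  set m := patternCount r C3rel
  set q := patternCount r C4rel
  set N := (Fintype.card V).choose 2
  have h6 : S ^ 2 ≤ N * (S + 2 * q) :=
    h5.trans (Nat.mul_le_mul h1 (h2.trans (by omega)))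
  zify at h4 h6
  by_cases hc : (3 * m : ℤ) ≤ N
  · have : (0:ℤ) ≤ 2 * q * N := by positivity
    have : (3 * m : ℤ) * (N - 3 * m) ≥ 0 := mul_nonneg (by positivity) (by linarith)
    nlinarith
  · push Not at hc
    nlinarith [mul_nonneg (sub_nonneg.2 h4) (show (0:ℤ) ≤ S + 3 * m - N by linarith)]

lemma density_ineq {r : V → V → Prop} (h : IsTournament r) (ε : ℝ) (hε : 0 < ε)
    (hn : 4 ≤ Fintype.card V) (hN : 6 ≤ ε * ((Fintype.card V : ℝ) - 3)) :
    6 * (patternDensity r C3rel) ^ 2 - ε ≤ patternDensity r C4rel := by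
  have H := main_ineq h
  have H' : 9 * (patternCount r C3rel : ℝ) ^ 2 -
          3 * (patternCount r C3rel : ℝ) * ((Fintype.card V).choose 2) ≤
        2 * (patternCount r C4rel : ℝ) * ((Fintype.card V).choose 2) := by exact_mod_cast H
  have hc : (patternCount r C3rel : ℝ) ≤ (Fintype.card V).choose 3 := by
    exact_mod_cast count_le (r := r)
  unfold patternDensity
  generalize Fintype.card V = n at *
  have c3 : ((n.choose 3 : ℕ) : ℝ) * 3 = n.choose 2 * ((n : ℝ) - 2) := by
    have := Nat.choose_succ_right_eq n 2
    have h2 : ((n - 2 : ℕ) : ℝ) = (n : ℝ) - 2 := by rw [Nat.cast_sub (by omega)]; norm_num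
    rw [← h2]; exact_mod_cast this
  have c4 : ((n.choose 4 : ℕ) : ℝ) * 4 = n.choose 3 * ((n : ℝ) - 3) := by
    have := Nat.choose_succ_right_eq n 3
    have h2 : ((n - 3 : ℕ) : ℝ) = (n : ℝ) - 3 := by rw [Nat.cast_sub (by omega)]; norm_num
    rw [← h2]; exact_mod_cast this
  have p2 : (0:ℝ) < n.choose 2 := by exact_mod_cast Nat.choose_pos (by omega)
  have p3 : (0:ℝ) < n.choose 3 := by exact_mod_cast Nat.choose_pos (by omega)
  have p4 : (0:ℝ) < n.choose 4 := by exact_mod_cast Nat.choose_pos (by omega)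
  have hn' : (4:ℝ) ≤ n := by exact_mod_cast hn
  generalize (patternCount r C3rel : ℝ) = m at *
  generalize (patternCount r C4rel : ℝ) = q at *
  generalize ((n.choose 2 : ℕ) : ℝ) = A at *
  generalize ((n.choose 3 : ℕ) : ℝ) = B at *
  generalize ((n.choose 4 : ℕ) : ℝ) = D at *
  obtain ⟨c, rfl⟩ : ∃ c, m = c * B := ⟨m / B, by field_simp⟩
  obtain ⟨d, rfl⟩ : ∃ d, q = d * D := ⟨q / D, by field_simp⟩
  rw [mul_div_cancel_right₀ _ p3.ne', mul_div_cancel_right₀ _ p4.ne']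
  have hc1 : c ≤ 1 := by nlinarith
  have e1 : 0 ≤ (B * A) * (d * ((n : ℝ) - 3) / 2 - (3 * c ^ 2 * ((n : ℝ) - 2) - 3 * c)) := by
    have e2 : (B * A) * (d * ((n : ℝ) - 3) / 2 - (3 * c ^ 2 * ((n : ℝ) - 2) - 3 * c)) =
        2 * (d * D) * A - (9 * (c * B) ^ 2 - 3 * (c * B) * A) := by
      linear_combination (-(d * A) / 2) * c4 + 3 * c ^ 2 * B * c3
    rw [e2]; linarith
  have e3 := nonneg_of_mul_nonneg_right e1 (mul_pos p3 p2)
  have e4 : (6 * c ^ 2 - ε) * ((n : ℝ) - 3) ≤ d * ((n : ℝ) - 3) := by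
    nlinarith [sq_nonneg c]
  exact le_of_mul_le_mul_right e4 (by linarith)

end Helpers

/-- If a tournament on `n ≥ 2` vertices has `m` cyclic triangles and `q` four-subsets
inducing `C₄`, then `2·q·C(n,2) ≥ 9m² - 3m·C(n,2)`; consequently every large tournament
satisfies `c₄ ≥ 6c₃² - ε`. -/
theorem c4_ge_six_c3_squared :
    (∀ (V : Type) [Fintype V] (r : V → V → Prop), IsTournament r →
      2 ≤ Fintype.card V →
      (9 * (patternCount r C3rel : ℤ) ^ 2 -
          3 * (patternCount r C3rel : ℤ) * ((Fintype.card V).choose 2) ≤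
        2 * (patternCount r C4rel : ℤ) * ((Fintype.card V).choose 2))) ∧
    ∀ ε : ℝ, 0 < ε → ∃ N : ℕ, ∀ (V : Type) [Fintype V] (r : V → V → Prop),
      IsTournament r → N ≤ Fintype.card V →
      6 * (patternDensity r C3rel) ^ 2 - ε ≤ patternDensity r C4rel := by
  refine ⟨fun V _ r h _ => main_ineq h, fun ε hε => ?_⟩
  obtain ⟨K, hK⟩ := exists_nat_ge (6 / ε)
  refine ⟨K + 4, fun V _ r h hn => density_ineq h ε hε (by omega) ?_⟩
  have hn' : (K : ℝ) + 4 ≤ Fintype.card V := by exact_mod_cast hn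
  rw [div_le_iff₀ hε] at hK
  nlinarith
end

section
/- For every ε > 0 there exists N such that every tournament T on n ≥ N vertices with t₄(T) ≤ 1/2 satisfies c₄(T) ≥ 1/6 − ε. -/
open Finset

open Classical in
/-- The signed adjacency matrix of a relation. -/
noncomputable def sgn {V : Type} (r : V → V → Prop) (u v : V) : ℤ :=
  (if r u v then 1 else 0) - (if r v u then 1 else 0)

lemma sgn_skew {V : Type} (r : V → V → Prop) (u v : V) : sgn r v u = - sgn r u v := by
  unfold sgn; ring

lemma sgn_abs {V : Type} (r : V → V → Prop) (u v : V) : |sgn r u v| ≤ 1 := by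
  unfold sgn; split_ifs <;> norm_num

/-- The signed product around a 4-cycle. -/
noncomputable def cyc {V : Type} (r : V → V → Prop) (f : Fin 4 → V) : ℤ :=
  sgn r (f 0) (f 1) * sgn r (f 1) (f 2) * sgn r (f 2) (f 3) * sgn r (f 3) (f 0)

lemma cyc_le {V : Type} (r : V → V → Prop) (f : Fin 4 → V) : cyc r f ≤ 1 := by
  refine (le_abs_self _).trans ?_
  unfold cyc
  rw [abs_mul, abs_mul, abs_mul]
  have h := sgn_abs r
  exact mul_le_one₀ (mul_le_one₀ (mul_le_one₀ (h _ _) (abs_nonneg _) (h _ _))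
    (abs_nonneg _) (h _ _)) (abs_nonneg _) (h _ _)

/-- Functions from `Fin 4` as quadruples. -/
def quadEquiv (V : Type) : (Fin 4 → V) ≃ (V × V) × (V × V) where
  toFun f := ((f 0, f 2), (f 1, f 3))
  invFun p := ![p.1.1, p.2.1, p.1.2, p.2.2]
  left_inv f := by ext i; fin_cases i <;> rfl
  right_inv p := rfl

lemma sum_cyc_nonneg {V : Type} [Fintype V] [DecidableEq V] (r : V → V → Prop) :
    0 ≤ ∑ f : Fin 4 → V, cyc r f := by
  have h : ∑ f : Fin 4 → V, cyc r f = ∑ p : (V × V) × (V × V),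
      (sgn r p.1.1 p.2.1 * sgn r p.2.1 p.1.2) * (sgn r p.1.1 p.2.2 * sgn r p.2.2 p.1.2) := by
    refine Fintype.sum_equiv (quadEquiv V) _ _ fun f => ?_
    change cyc r f = (sgn r (f 0) (f 1) * sgn r (f 1) (f 2)) *
      (sgn r (f 0) (f 3) * sgn r (f 3) (f 2))
    unfold cyc
    rw [sgn_skew r (f 3) (f 2), sgn_skew r (f 0) (f 3)]
    ring
  rw [h, Fintype.sum_prod_type]
  refine Finset.sum_nonneg fun p _ => ?_
  rw [Fintype.sum_prod_type]
  simp only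
  rw [← Finset.sum_mul_sum]
  exact mul_self_nonneg _

/-- The sum of the three signed 4-cycles. -/
noncomputable def cyc3 {V : Type} (r : V → V → Prop) (f : Fin 4 → V) : ℤ :=
  cyc r f + cyc r (f ∘ Equiv.swap 2 3) + cyc r (f ∘ Equiv.swap 1 2)

lemma sum_cyc3_nonneg {V : Type} [Fintype V] [DecidableEq V] (r : V → V → Prop) :
    0 ≤ ∑ f : Fin 4 → V, cyc3 r f := by
  have h : ∀ σ : Equiv.Perm (Fin 4),
      ∑ f : Fin 4 → V, cyc r (f ∘ σ) = ∑ f : Fin 4 → V, cyc r f := fun σ =>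
    Fintype.sum_equiv (Equiv.arrowCongr σ.symm (Equiv.refl V)) _ _ fun f => rfl
  unfold cyc3
  rw [Finset.sum_add_distrib, Finset.sum_add_distrib, h, h]
  have := sum_cyc_nonneg r
  linarith

lemma cyc3_le {V : Type} (r : V → V → Prop) (f : Fin 4 → V) : cyc3 r f ≤ 3 := by
  have := cyc_le r f
  have := cyc_le r (f ∘ Equiv.swap 2 3)
  have := cyc_le r (f ∘ Equiv.swap 1 2)
  unfold cyc3
  linarith

instance : DecidableRel T4rel := fun i j => inferInstanceAs (Decidable (i < j))

instance : DecidableRel C4rel := fun i j => by unfold C4rel; infer_instance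

/-- The tournament on `Fin 4` given by six bits. -/
def bitRel (a b c d e g : Bool) : Fin 4 → Fin 4 → Bool :=
  ![![false, a, b, c], ![!a, false, d, e], ![!b, !d, false, g], ![!c, !e, !g, false]]

/-- The sign of a bit. -/
def bsgn (a : Bool) : ℤ := if a then 1 else -1

lemma classify : ∀ a b c d e g : Bool,
    bsgn a * bsgn d * bsgn g * bsgn (!c) + bsgn a * bsgn e * bsgn (!g) * bsgn (!b)
      + bsgn b * bsgn (!d) * bsgn e * bsgn (!c) = -3 ∨
    (bsgn a * bsgn d * bsgn g * bsgn (!c) + bsgn a * bsgn e * bsgn (!g) * bsgn (!b)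
      + bsgn b * bsgn (!d) * bsgn e * bsgn (!c) = 1 ∧
    ∃ σ : Equiv.Perm (Fin 4),
      (∀ i j, T4rel i j ↔ bitRel a b c d e g (σ i) (σ j) = true) ∨
      (∀ i j, C4rel i j ↔ bitRel a b c d e g (σ i) (σ j) = true)) := by
  decide +kernel

lemma classify' {V : Type} [DecidableEq V] (r : V → V → Prop) (hr : IsTournament r)
    (f : Fin 4 ↪ V) :
    cyc3 r f = -3 ∨ (cyc3 r f = 1 ∧ (InducesPattern r T4rel (univ.map f) ∨
      InducesPattern r C4rel (univ.map f))) := by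
  classical
  have hne : ∀ i j : Fin 4, i ≠ j → (r (f i) (f j) ↔ ¬ r (f j) (f i)) := fun i j h =>
    hr.2 _ _ (fun h' => h (f.injective h'))
  have hs : ∀ i j : Fin 4, i ≠ j → sgn r (f i) (f j) = bsgn (decide (r (f i) (f j))) := by
    intro i j h
    have := hne i j h
    unfold sgn bsgn
    by_cases h1 : r (f i) (f j) <;> by_cases h2 : r (f j) (f i) <;> simp_all
  have hn : ∀ i j : Fin 4, i ≠ j → decide (r (f j) (f i)) = !decide (r (f i) (f j)) := by
    intro i j h
    have := hne i j h
    by_cases h1 : r (f i) (f j) <;> by_cases h2 : r (f j) (f i) <;> simp_all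
  have hb : ∀ i j : Fin 4, r (f i) (f j) ↔ bitRel (decide (r (f 0) (f 1)))
      (decide (r (f 0) (f 2))) (decide (r (f 0) (f 3))) (decide (r (f 1) (f 2)))
      (decide (r (f 1) (f 3))) (decide (r (f 2) (f 3))) i j = true := by
    have h10 := hne 1 0 (by decide)
    have h20 := hne 2 0 (by decide)
    have h30 := hne 3 0 (by decide)
    have h21 := hne 2 1 (by decide)
    have h31 := hne 3 1 (by decide)
    have h32 := hne 3 2 (by decide)
    intro i j
    fin_cases i <;> fin_cases j <;> simp [bitRel, hr.1, h10, h20, h30, h21, h31, h32]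
  have hc : cyc3 r f = bsgn (decide (r (f 0) (f 1))) * bsgn (decide (r (f 1) (f 2))) *
      bsgn (decide (r (f 2) (f 3))) * bsgn (!decide (r (f 0) (f 3))) +
      bsgn (decide (r (f 0) (f 1))) * bsgn (decide (r (f 1) (f 3))) *
      bsgn (!decide (r (f 2) (f 3))) * bsgn (!decide (r (f 0) (f 2))) +
      bsgn (decide (r (f 0) (f 2))) * bsgn (!decide (r (f 1) (f 2))) *
      bsgn (decide (r (f 1) (f 3))) * bsgn (!decide (r (f 0) (f 3))) := by
    have e1 : (Equiv.swap (2 : Fin 4) 3) 0 = 0 := by decide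
    have e2 : (Equiv.swap (2 : Fin 4) 3) 1 = 1 := by decide
    have e3 : (Equiv.swap (1 : Fin 4) 2) 0 = 0 := by decide
    have e4 : (Equiv.swap (1 : Fin 4) 2) 3 = 3 := by decide
    simp only [cyc3, cyc, Function.comp, e1, e2, e3, e4, Equiv.swap_apply_left,
      Equiv.swap_apply_right]
    rw [← hn 0 3 (by decide), ← hn 2 3 (by decide), ← hn 0 2 (by decide), ← hn 1 2 (by decide)]
    rw [← hs 0 1 (by decide), ← hs 1 2 (by decide), ← hs 2 3 (by decide), ← hs 3 0 (by decide),
      ← hs 1 3 (by decide), ← hs 3 2 (by decide), ← hs 2 0 (by decide), ← hs 0 2 (by decide),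
      ← hs 2 1 (by decide)]
  have key : ∀ (m : Fin 4 → Fin 4 → Prop) (σ : Equiv.Perm (Fin 4)),
      (∀ i j, m i j ↔ r (f (σ i)) (f (σ j))) → InducesPattern r m (univ.map f) := by
    intro m σ h
    refine ⟨f ∘ σ, f.injective.comp σ.injective, ?_, h⟩
    rw [Set.range_comp, σ.surjective.range_eq]
    simp
  rw [hc]
  rcases classify (decide (r (f 0) (f 1)))
      (decide (r (f 0) (f 2))) (decide (r (f 0) (f 3))) (decide (r (f 1) (f 2)))
      (decide (r (f 1) (f 3))) (decide (r (f 2) (f 3))) with h | ⟨h, σ, h' | h'⟩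
  · exact Or.inl h
  · exact Or.inr ⟨h, Or.inl (key _ σ fun i j => (h' i j).trans (hb _ _).symm)⟩
  · exact Or.inr ⟨h, Or.inr (key _ σ fun i j => (h' i j).trans (hb _ _).symm)⟩

lemma emb_count {V : Type} [Fintype V] [DecidableEq V] (S : Finset (Finset V))
    (hS : ∀ s ∈ S, s.card = 4) :
    ((univ : Finset (Fin 4 ↪ V)).filter (fun f => univ.map f ∈ S)).card ≤ 24 * S.card := by
  refine Finset.card_le_mul_card_image_of_maps_to (f := fun f : Fin 4 ↪ V => univ.map f)
    (fun f hf => (Finset.mem_filter.1 hf).2) 24 ?_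
  intro s hs
  have h24 : Fintype.card (Fin 4 ↪ s) = 24 := by
    rw [Fintype.card_embedding_eq, Fintype.card_coe, hS s hs]; rfl
  rw [← h24, ← Finset.card_univ]
  refine Finset.card_le_card_of_surjOn
    (fun g : Fin 4 ↪ s => g.trans (Function.Embedding.subtype _)) ?_
  intro f hf
  have hf' : univ.map f = s := by simpa using (Finset.mem_filter.1 hf).2
  refine ⟨⟨fun i => ⟨f i, ?_⟩, fun i j h => f.injective (by simpa using h)⟩, by simp, ?_⟩
  · rw [← hf']; simp
  · ext i; rfl

lemma sgn_main {V : Type} [Fintype V] (r : V → V → Prop) (hr : IsTournament r) :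
    (6 : ℤ) * ((Fintype.card V).descFactorial 4 : ℕ) - 3 * (Fintype.card V : ℤ) ^ 4 ≤
      96 * ((patternCount r T4rel : ℤ) + patternCount r C4rel) := by
  classical
  set S : Finset (Finset V) :=
    ((univ : Finset V).powersetCard 4).filter (fun s => InducesPattern r T4rel s) ∪
    ((univ : Finset V).powersetCard 4).filter (fun s => InducesPattern r C4rel s) with hSdef
  have hS : ∀ s ∈ S, s.card = 4 := by
    intro s hs
    simp only [hSdef, Finset.mem_union, Finset.mem_filter, Finset.mem_powersetCard] at hs
    tauto
  have hScard : S.card ≤ patternCount r T4rel + patternCount r C4rel := by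
    unfold patternCount
    convert Finset.card_union_le _ _
  have hE := emb_count S hS
  have hcardE : (univ : Finset (Fin 4 ↪ V)).card = (Fintype.card V).descFactorial 4 := by
    rw [Finset.card_univ, Fintype.card_embedding_eq, Fintype.card_fin]
  -- the sum over embeddings, from above
  have hup : ∑ f : Fin 4 ↪ V, (cyc3 r f + 3) ≤
      4 * (((univ : Finset (Fin 4 ↪ V)).filter (fun f => univ.map f ∈ S)).card : ℤ) := by
    rw [Finset.card_filter]
    push_cast
    rw [Finset.mul_sum]
    refine Finset.sum_le_sum fun f _ => ?_
    rcases classify' r hr f with h | ⟨h, h'⟩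
    · rw [h]; split_ifs <;> norm_num
    · have : univ.map f ∈ S := by
        simp only [hSdef, Finset.mem_union, Finset.mem_filter, Finset.mem_powersetCard]
        have hc : (univ.map f).card = 4 := by simp
        have hsub := Finset.subset_univ (univ.map f)
        tauto
      rw [if_pos this, h]; norm_num
  -- and from below
  have hlow : ∑ f : Fin 4 ↪ V, (3 - cyc3 r f) ≤ ∑ f : Fin 4 → V, (3 - cyc3 r f) := by
    have : ∑ f : Fin 4 ↪ V, (3 - cyc3 r f) = ∑ f ∈ (univ : Finset (Fin 4 ↪ V)).map
        (⟨DFunLike.coe, DFunLike.coe_injective⟩ : (Fin 4 ↪ V) ↪ (Fin 4 → V)), (3 - cyc3 r f) := by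
      rw [Finset.sum_map]; rfl
    rw [this]
    refine Finset.sum_le_sum_of_subset_of_nonneg (Finset.subset_univ _) fun f _ _ => ?_
    have := cyc3_le r f
    linarith
  have hnn := sum_cyc3_nonneg r
  rw [Finset.sum_sub_distrib, Finset.sum_sub_distrib, Finset.sum_const, Finset.sum_const,
    hcardE, Finset.card_univ, Fintype.card_fun, Fintype.card_fin] at hlow
  rw [Finset.sum_add_distrib, Finset.sum_const, hcardE] at hup
  simp only [nsmul_eq_mul] at hlow hup
  push_cast at hlow
  zify at hE hScard
  linarith

/-- Every large tournament with `t₄ ≤ 1/2` satisfies `c₄ ≥ 1/6 - ε`. -/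
theorem c4_ge_one_sixth_of_t4_le_half :
    ∀ ε : ℝ, 0 < ε → ∃ N : ℕ, ∀ (V : Type) [Fintype V] (r : V → V → Prop),
      IsTournament r → N ≤ Fintype.card V →
      patternDensity r T4rel ≤ 1 / 2 →
      1 / 6 - ε ≤ patternDensity r C4rel := by
  intro ε hε
  refine ⟨100, fun V _ r hr hN ht => ?_⟩
  have hm := sgn_main r hr
  have hD : (Fintype.card V).descFactorial 4 = 24 * (Fintype.card V).choose 4 := by
    rw [Nat.descFactorial_eq_factorial_mul_choose]; rfl
  have hD2 : (((Fintype.card V).descFactorial 4 : ℕ) : ℝ) =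
      (Fintype.card V : ℝ) * (Fintype.card V - 1) * (Fintype.card V - 2) *
        (Fintype.card V - 3) := by
    obtain ⟨k, hk⟩ : ∃ k, Fintype.card V = k + 3 := ⟨Fintype.card V - 3, by omega⟩
    rw [hk]
    simp only [Nat.descFactorial_succ, Nat.descFactorial_zero]
    have h1 : k + 3 - 3 = k := by omega
    have h2 : k + 3 - 2 = k + 1 := by omega
    have h3 : k + 3 - 1 = k + 2 := by omega
    rw [h1, h2, h3]
    push_cast
    ring
  have hmR : (6 : ℝ) * ((Fintype.card V).descFactorial 4 : ℕ) - 3 * (Fintype.card V : ℝ) ^ 4 ≤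
      96 * ((patternCount r T4rel : ℝ) + patternCount r C4rel) := by exact_mod_cast hm
  have hn : (100 : ℝ) ≤ (Fintype.card V : ℝ) := by exact_mod_cast hN
  have hDR : (((Fintype.card V).descFactorial 4 : ℕ) : ℝ) =
      24 * ((Fintype.card V).choose 4 : ℝ) := by exact_mod_cast hD
  unfold patternDensity at ht ⊢
  generalize (Fintype.card V : ℝ) = n at *
  have hcmp : 9 * n ^ 4 ≤ 10 * (n * (n - 1) * (n - 2) * (n - 3)) := by
    obtain ⟨k, rfl⟩ : ∃ k, n = k + 100 := ⟨n - 100, by ring⟩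
    have hk : 0 ≤ k := by linarith
    rw [← sub_nonneg]
    ring_nf
    positivity
  rw [hD2] at hDR hmR
  have hpos : (0 : ℝ) < ((Fintype.card V).choose 4 : ℝ) := by
    have : (0 : ℝ) < n ^ 4 := by positivity
    linarith
  rw [div_le_iff₀ hpos] at ht
  rw [le_div_iff₀ hpos]
  nlinarith [mul_pos hε hpos]
end
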